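/- Let F = {F_0, ..., F_{t-2}} be a one-factorization of K_t (t even), with the pairs of each F_i arbitrarily ordered as F_{i,0}, ..., F_{i,(t-2)/2}. For fixed i, s ∈ {0,...,t-2}, r ∈ {0,...,(t-2)/2}, and distinct a,b,c,d ∈ Z_4 with {a,b,c,d} = Z_4, the set { {(x,a),(y,a),(z,b),(v,b)}, {(x,c),(y,c),(z,d),(v,d)} : {x,y} = F_{i,j}, {z,v} = F_{s,j+r}, 0 ≤ j ≤ (t-2)/2 } (index j+r taken mod t/2) consists of t pairwise disjoint quadruples whose union is Z_t × Z_4, i.e., it is a parallel class. -/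

import Mathlib

/-- The Type-3 parallel class determined by one-factors `F_i`, `F_s`, a shift `r`,
and layers `a,b,c,d`: for each `j`, with `F_{i,j} = {x,y}` and `F_{s,j+r} = {z,v}`,
it contains the quadruples `{(x,a),(y,a),(z,b),(v,b)}` and `{(x,c),(y,c),(z,d),(v,d)}`. -/
def type3Class (t : ℕ) (F : Fin (t - 1) → Fin (t / 2) → Finset (Fin t))
    (i s : Fin (t - 1)) (r : Fin (t / 2)) (a b c d : Fin 4) :
    Set (Finset (Fin t × Fin 4)) :=
  {Q | ∃ j : Fin (t / 2), ∃ x y z v : Fin t, x ≠ y ∧ z ≠ v ∧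
    F i j = {x, y} ∧ F s (j + r) = {z, v} ∧
    (Q = {(x, a), (y, a), (z, b), (v, b)} ∨ Q = {(x, c), (y, c), (z, d), (v, d)})}

/-- The quadruple `A × {a} ∪ B × {b}`, for pairs `A`, `B` and layers `a`, `b`. -/
def layeredPairs {t : ℕ} (A B : Finset (Fin t)) (a b : Fin 4) : Finset (Fin t × Fin 4) :=
  A ×ˢ {a} ∪ B ×ˢ {b}

theorem mem_layeredPairs {t : ℕ} {A B : Finset (Fin t)} {a b : Fin 4} {p : Fin t × Fin 4} :
    p ∈ layeredPairs A B a b ↔ p.1 ∈ A ∧ p.2 = a ∨ p.1 ∈ B ∧ p.2 = b := by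
  simp only [layeredPairs, Finset.mem_union, Finset.mem_product, Finset.mem_singleton]

theorem layeredPairs_pair {t : ℕ} (x y z v : Fin t) (a b : Fin 4) :
    layeredPairs {x, y} {z, v} a b = {(x, a), (y, a), (z, b), (v, b)} := by
  ext ⟨p, q⟩
  simp only [mem_layeredPairs, Finset.mem_insert, Finset.mem_singleton, Prod.mk.injEq]
  tauto

/-- The quadruples of the Type-3 class, indexed by `j` and the choice of layers. -/
def type3Block {t : ℕ} (F : Fin (t - 1) → Fin (t / 2) → Finset (Fin t))
    (i s : Fin (t - 1)) (r : Fin (t / 2)) (a b c d : Fin 4) (k : Fin (t / 2) × Bool) :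
    Finset (Fin t × Fin 4) :=
  layeredPairs (F i k.1) (F s (k.1 + r)) (bif k.2 then a else c) (bif k.2 then b else d)

theorem type3Class_eq_range {t : ℕ} {F : Fin (t - 1) → Fin (t / 2) → Finset (Fin t)}
    (hcard : ∀ i j, (F i j).card = 2) (i s : Fin (t - 1)) (r : Fin (t / 2)) (a b c d : Fin 4) :
    type3Class t F i s r a b c d = Set.range (type3Block F i s r a b c d) := by
  ext Q
  constructor
  · rintro ⟨j, x, y, z, v, -, -, h₁, h₂, rfl | rfl⟩
    · exact ⟨(j, true), by simp [type3Block, h₁, h₂, layeredPairs_pair]⟩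
    · exact ⟨(j, false), by simp [type3Block, h₁, h₂, layeredPairs_pair]⟩
  · rintro ⟨⟨j, e⟩, rfl⟩
    obtain ⟨x, y, hxy, h₁⟩ := Finset.card_eq_two.mp (hcard i j)
    obtain ⟨z, v, hzv, h₂⟩ := Finset.card_eq_two.mp (hcard s (j + r))
    refine ⟨j, x, y, z, v, hxy, hzv, h₁, h₂, ?_⟩
    cases e <;> simp [type3Block, h₁, h₂, layeredPairs_pair]

theorem layers_distinct : ∀ {a b c d : Fin 4},
    ({a, b, c, d} : Finset (Fin 4)) = Finset.univ →
      a ≠ b ∧ a ≠ c ∧ a ≠ d ∧ b ≠ c ∧ b ≠ d ∧ c ≠ d := by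
  decide

theorem existsUnique_mem_type3Block {t : ℕ} {F : Fin (t - 1) → Fin (t / 2) → Finset (Fin t)}
    (hF : ∀ i x, ∃! j, x ∈ F i j) (i s : Fin (t - 1)) (r : Fin (t / 2)) {a b c d : Fin 4}
    (habcd : ({a, b, c, d} : Finset (Fin 4)) = Finset.univ) (p : Fin t × Fin 4) :
    ∃! k, p ∈ type3Block F i s r a b c d k := by
  have : NeZero (t / 2) := ⟨by have := r.isLt; omega⟩
  obtain ⟨x, e⟩ := p
  obtain ⟨j, hj, hj'⟩ := hF i x
  obtain ⟨l, hl, hl'⟩ := hF s x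
  obtain ⟨hab, hac, had, hbc, hbd, hcd⟩ := layers_distinct habcd
  have he : e ∈ ({a, b, c, d} : Finset (Fin 4)) := habcd ▸ Finset.mem_univ e
  have hl₂ : x ∈ F s (l - r + r) := by rwa [sub_add_cancel]
  have hl₃ : ∀ m, x ∈ F s (m + r) → m = l - r := fun m hm => eq_sub_of_add_eq (hl' _ hm)
  simp only [Finset.mem_insert, Finset.mem_singleton] at he
  rcases he with rfl | rfl | rfl | rfl
  · refine ⟨(j, true), by simp [type3Block, mem_layeredPairs, hj], ?_⟩
    rintro ⟨m, _ | _⟩ h <;> grind [type3Block, mem_layeredPairs]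
  · refine ⟨(l - r, true), by simp [type3Block, mem_layeredPairs, hl], ?_⟩
    rintro ⟨m, _ | _⟩ h <;> grind [type3Block, mem_layeredPairs]
  · refine ⟨(j, false), by simp [type3Block, mem_layeredPairs, hj], ?_⟩
    rintro ⟨m, _ | _⟩ h <;> grind [type3Block, mem_layeredPairs]
  · refine ⟨(l - r, false), by simp [type3Block, mem_layeredPairs, hl], ?_⟩
    rintro ⟨m, _ | _⟩ h <;> grind [type3Block, mem_layeredPairs]

/-- Given a one-factorization of `K_t` (t even) with ordered pairs
`F_{i,0}, ..., F_{i,(t-2)/2}` in each one-factor, for fixed `i,s`, shift `r`, and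
distinct `a,b,c,d` with `{a,b,c,d} = Z_4`, the set of quadruples
`{(x,a),(y,a),(z,b),(v,b)}, {(x,c),(y,c),(z,d),(v,d)}` over `{x,y} = F_{i,j}`,
`{z,v} = F_{s,j+r}` consists of `t` pairwise disjoint quadruples whose union is
`Z_t × Z_4`, i.e. it is a parallel class. -/
theorem type3_parallel_class (t : ℕ) (ht : 2 ≤ t) (heven : Even t)
    (F : Fin (t - 1) → Fin (t / 2) → Finset (Fin t))
    (hcard : ∀ i j, (F i j).card = 2)
    (hdisjF : ∀ i, ∀ j j', j ≠ j' → Disjoint (F i j) (F i j'))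
    (hcoverF : ∀ i, ∀ x : Fin t, ∃ j, x ∈ F i j)
    (hpart : ∀ e : Finset (Fin t), e.card = 2 →
      ∃! p : Fin (t - 1) × Fin (t / 2), F p.1 p.2 = e)
    (i s : Fin (t - 1)) (r : Fin (t / 2)) (a b c d : Fin 4)
    (habcd : ({a, b, c, d} : Finset (Fin 4)) = Finset.univ) :
    (type3Class t F i s r a b c d).ncard = t ∧
    (∀ Q ∈ type3Class t F i s r a b c d, ∀ Q' ∈ type3Class t F i s r a b c d,
      Q ≠ Q' → Disjoint Q Q') ∧
    (∀ p : Fin t × Fin 4, ∃ Q ∈ type3Class t F i s r a b c d, p ∈ Q) := by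
  have hF : ∀ i x, ∃! j, x ∈ F i j := fun i x => by
    obtain ⟨j, hj⟩ := hcoverF i x
    refine ⟨j, hj, fun l hl => ?_⟩
    by_contra hne
    exact Finset.disjoint_left.mp (hdisjF i l j hne) hl hj
  have hmem := existsUnique_mem_type3Block hF i s r habcd
  rw [type3Class_eq_range hcard]
  refine ⟨?_, ?_, ?_⟩
  · have hinj : Function.Injective (type3Block F i s r a b c d) := fun k l hkl => by
      obtain ⟨x, hx⟩ := Finset.card_pos.mp (by rw [hcard i k.1]; exact two_pos)
      have hk : (x, bif k.2 then a else c) ∈ type3Block F i s r a b c d k :=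
        mem_layeredPairs.mpr (Or.inl ⟨hx, rfl⟩)
      exact (hmem _).unique hk (hkl ▸ hk)
    rw [← Set.image_univ, Set.ncard_image_of_injective _ hinj, Set.ncard_univ]
    simpa using Nat.div_mul_cancel heven.two_dvd
  · rintro _ ⟨k, rfl⟩ _ ⟨l, rfl⟩ hne
    rw [Finset.disjoint_left]
    exact fun p hk hl => hne (congrArg _ ((hmem p).unique hk hl))
  · intro p
    obtain ⟨k, hk, -⟩ := hmem p
    exact ⟨_, ⟨k, rfl⟩, hk⟩
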